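/- Let m ≥ 0 and let h : [0,1) → ℝ be continuous with h(t) ≥ −m for all t ∈ [0,1) and ∫₀ᵗ h(r) dr → +∞ as t → 1⁻. Let N : [0,1] → ℝ be continuous. Then lim_{t→1⁻} [ N(t) − ∫₀ᵗ N(r)·h(r)·exp(−∫ᵣᵗ h(s) ds) dr ] = 0. (This deterministic limit is the analytic core of the proof of Proposition 2: applied pathwise to N(t) = ∫₀ᵗ σ(r) dB_r it yields lim_{t→1⁻} φ(t)M_t = 0 for M_t = ∫₀ᵗ (σ(r)/φ(r)) dB_r.) -/

import Mathlib

open Filter Topology Set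

lemma uIcc_subset_Ico_zero_one {a b : ℝ} (ha : 0 ≤ a) (hab : a ≤ b) (hb : b < 1) :
    uIcc a b ⊆ Ico 0 1 := by
  rw [uIcc_of_le hab]
  exact Icc_subset_Ico_iff hab |>.2 ⟨ha, hb⟩

lemma intervalIntegrable_of_continuousOn_Ico {f : ℝ → ℝ} (hf : ContinuousOn f (Ico 0 1))
    {a b : ℝ} (ha : 0 ≤ a) (hab : a ≤ b) (hb : b < 1) :
    IntervalIntegrable f MeasureTheory.volume a b :=
  (hf.mono (uIcc_subset_Ico_zero_one ha hab hb)).intervalIntegrable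

lemma continuousOn_primitive_Ico {h : ℝ → ℝ} (hh : ContinuousOn h (Ico 0 1)) :
    ContinuousOn (fun t => ∫ r in (0:ℝ)..t, h r) (Ico 0 1) := by
  intro t ht
  obtain ⟨b, htb, hb⟩ := exists_between ht.2
  have hb0 : 0 ≤ b := ht.1.trans htb.le
  have hc : ContinuousOn (fun t => ∫ r in (0:ℝ)..t, h r) (uIcc 0 b) :=
    intervalIntegral.continuousOn_primitive_interval
      ((hh.mono (uIcc_subset_Ico_zero_one le_rfl hb0 hb)).integrableOn_compact isCompact_uIcc)
  rw [uIcc_of_le hb0] at hc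
  refine (hc t ⟨ht.1, htb.le⟩).mono_of_mem_nhdsWithin ?_
  filter_upwards [self_mem_nhdsWithin, mem_nhdsWithin_of_mem_nhds (Iio_mem_nhds htb)] with x hx hxb
  exact ⟨hx.1, le_of_lt hxb⟩

lemma hasDerivAt_primitive_Ico {h : ℝ → ℝ} (hh : ContinuousOn h (Ico 0 1))
    {t : ℝ} (ht : t ∈ Ioo (0:ℝ) 1) :
    HasDerivAt (fun t => ∫ r in (0:ℝ)..t, h r) (h t) t :=
  intervalIntegral.integral_hasDerivAt_right
    (intervalIntegrable_of_continuousOn_Ico hh le_rfl ht.1.le ht.2)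
    ((hh.mono Ioo_subset_Ico_self).stronglyMeasurableAtFilter isOpen_Ioo t ht)
    (hh.continuousAt (Ico_mem_nhds ht.1 ht.2))

lemma continuousOn_mul_exp_primitive {h : ℝ → ℝ} (hh : ContinuousOn h (Ico 0 1)) :
    ContinuousOn (fun r => h r * Real.exp (∫ s in (0:ℝ)..r, h s)) (Ico 0 1) :=
  hh.mul (continuousOn_primitive_Ico hh).rexp

lemma integral_mul_exp_primitive {h : ℝ → ℝ} (hh : ContinuousOn h (Ico 0 1))
    {a b : ℝ} (ha : 0 ≤ a) (hab : a ≤ b) (hb : b < 1) :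
    ∫ r in a..b, h r * Real.exp (∫ s in (0:ℝ)..r, h s) =
      Real.exp (∫ s in (0:ℝ)..b, h s) - Real.exp (∫ s in (0:ℝ)..a, h s) := by
  have hH := continuousOn_primitive_Ico hh
  refine intervalIntegral.integral_eq_sub_of_hasDerivAt_of_le hab
    (hH.rexp.mono ((Icc_subset_Ico_iff hab).2 ⟨ha, hb⟩)) (fun x hx => ?_)
    (intervalIntegrable_of_continuousOn_Ico (continuousOn_mul_exp_primitive hh) ha hab hb)
  simpa only [mul_comm] using
    (hasDerivAt_primitive_Ico hh ⟨ha.trans_lt hx.1, hx.2.trans hb⟩).exp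

lemma primitive_le_add {m : ℝ} (hm : 0 ≤ m) {h : ℝ → ℝ} (hh : ContinuousOn h (Ico 0 1))
    (hbd : ∀ t ∈ Ico (0:ℝ) 1, -m ≤ h t) {a b : ℝ} (ha : 0 ≤ a) (hab : a ≤ b) (hb : b < 1) :
    ∫ s in (0:ℝ)..a, h s ≤ (∫ s in (0:ℝ)..b, h s) + m := by
  have hint := intervalIntegrable_of_continuousOn_Ico hh ha hab hb
  have h1 := intervalIntegral.integral_add_adjacent_intervals
    (intervalIntegrable_of_continuousOn_Ico hh le_rfl ha (hab.trans_lt hb)) hint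
  have h2 : ∫ _ in a..b, -m ≤ ∫ s in a..b, h s :=
    intervalIntegral.integral_mono_on hab intervalIntegrable_const hint
      fun x hx => hbd x ⟨ha.trans hx.1, hx.2.trans_lt hb⟩
  rw [intervalIntegral.integral_const, smul_eq_mul] at h2
  nlinarith

lemma abs_integral_mul_exp_primitive_le {m : ℝ} (hm : 0 ≤ m) {h : ℝ → ℝ}
    (hh : ContinuousOn h (Ico 0 1)) (hbd : ∀ t ∈ Ico (0:ℝ) 1, -m ≤ h t) {W : ℝ → ℝ}
    {ε a b : ℝ} (hε : 0 ≤ ε) (ha : 0 ≤ a) (hab : a ≤ b) (hb : b < 1)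
    (hW : ∀ r ∈ Icc a b, |W r| ≤ ε) :
    |∫ r in a..b, W r * (h r * Real.exp (∫ s in (0:ℝ)..r, h s))| ≤
      ε * (1 + 2 * m * Real.exp m) * Real.exp (∫ s in (0:ℝ)..b, h s) := by
  have hi := intervalIntegrable_of_continuousOn_Ico
    (continuousOn_mul_exp_primitive hh) ha hab hb
  set E := Real.exp (∫ s in (0:ℝ)..b, h s) with hE
  have key : ∀ r ∈ Icc a b, |W r * (h r * Real.exp (∫ s in (0:ℝ)..r, h s))| ≤
      ε * (h r * Real.exp (∫ s in (0:ℝ)..r, h s) + 2 * m * (E * Real.exp m)) := by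
    intro r hr
    have hle : Real.exp (∫ s in (0:ℝ)..r, h s) ≤ E * Real.exp m := by
      rw [hE, ← Real.exp_add]
      exact Real.exp_le_exp.2 (primitive_le_add hm hh hbd (ha.trans hr.1) hr.2 hb)
    have hhr := hbd r ⟨ha.trans hr.1, hr.2.trans_lt hb⟩
    have habs : |h r| ≤ h r + 2 * m := abs_le.2 ⟨by linarith, by linarith⟩
    rw [abs_mul, abs_mul, Real.abs_exp]
    refine mul_le_mul (hW r hr) ?_ (by positivity) hε
    have := mul_le_mul_of_nonneg_right habs (Real.exp_pos (∫ s in (0:ℝ)..r, h s)).le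
    have := mul_le_mul_of_nonneg_left hle (by positivity : 0 ≤ 2 * m)
    linarith
  have hn := intervalIntegral.norm_integral_le_of_norm_le (μ := MeasureTheory.volume)
    (f := fun r => W r * (h r * Real.exp (∫ s in (0:ℝ)..r, h s)))
    (g := fun r => ε * (h r * Real.exp (∫ s in (0:ℝ)..r, h s) + 2 * m * (E * Real.exp m))) hab
    (Eventually.of_forall fun r hr => key r (Ioc_subset_Icc_self hr))
    ((hi.add intervalIntegrable_const).const_mul ε)
  rw [Real.norm_eq_abs, intervalIntegral.integral_const_mul,
    intervalIntegral.integral_add hi intervalIntegrable_const,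
    integral_mul_exp_primitive hh ha hab hb, intervalIntegral.integral_const, smul_eq_mul] at hn
  refine hn.trans ?_
  rw [mul_assoc ε]
  refine mul_le_mul_of_nonneg_left ?_ hε
  have hba : b - a ≤ 1 := by linarith
  have := mul_le_mul_of_nonneg_right hba (by positivity : 0 ≤ 2 * m * (E * Real.exp m))
  have := Real.exp_pos (∫ s in (0:ℝ)..a, h s)
  linarith

lemma tendsto_exp_neg_mul_integral_mul_exp_primitive {m : ℝ} (hm : 0 ≤ m) {h : ℝ → ℝ}
    (hh : ContinuousOn h (Ico 0 1)) (hbd : ∀ t ∈ Ico (0:ℝ) 1, -m ≤ h t)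
    (hdiv : Tendsto (fun t => ∫ r in (0:ℝ)..t, h r) (𝓝[<] 1) atTop) {W : ℝ → ℝ}
    (hW : ContinuousOn W (Ico 0 1)) (hW0 : Tendsto W (𝓝[<] 1) (𝓝 0)) :
    Tendsto (fun t => Real.exp (-∫ s in (0:ℝ)..t, h s) *
      ∫ r in (0:ℝ)..t, W r * (h r * Real.exp (∫ s in (0:ℝ)..r, h s))) (𝓝[<] 1) (𝓝 0) := by
  have hexp : Tendsto (fun t => Real.exp (-∫ s in (0:ℝ)..t, h s)) (𝓝[<] 1) (𝓝 0) :=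
    Real.tendsto_exp_neg_atTop_nhds_zero.comp hdiv
  have hf : ContinuousOn (fun r => W r * (h r * Real.exp (∫ s in (0:ℝ)..r, h s))) (Ico 0 1) :=
    hW.mul (continuousOn_mul_exp_primitive hh)
  set K := 1 + 2 * m * Real.exp m with hK
  have hKpos : 0 < K := by positivity
  rw [Metric.tendsto_nhds]
  intro η hη
  have hε : 0 < η / (2 * K) := by positivity
  obtain ⟨l, hl, hlW⟩ := (mem_nhdsLT_iff_exists_Ioo_subset).1
    ((Metric.tendsto_nhds.1 hW0) _ hε)
  obtain ⟨a, hal, ha1⟩ := exists_between (max_lt hl (zero_lt_one' ℝ))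
  have ha0 : 0 ≤ a := (le_max_right _ _).trans hal.le
  have hC := hexp.mul_const (∫ r in (0:ℝ)..a, W r * (h r * Real.exp (∫ s in (0:ℝ)..r, h s)))
  rw [zero_mul] at hC
  filter_upwards [Metric.tendsto_nhds.1 hC (η / 2) (half_pos hη), Ioo_mem_nhdsLT ha1] with t hCt ht
  have hb := abs_integral_mul_exp_primitive_le hm hh hbd hε.le ha0 ht.1.le ht.2 (W := W)
    fun r hr => by
      have hr' : dist (W r) 0 < η / (2 * K) :=
        hlW ⟨(le_max_left _ _).trans_lt (hal.trans_le hr.1), hr.2.trans_lt ht.2⟩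
      exact (Real.dist_0_eq_abs (W r) ▸ hr').le
  rw [← intervalIntegral.integral_add_adjacent_intervals
    (intervalIntegrable_of_continuousOn_Ico hf le_rfl ha0 ha1)
    (intervalIntegrable_of_continuousOn_Ico hf ha0 ht.1.le ht.2), mul_add]
  rw [Real.dist_0_eq_abs] at hCt ⊢
  refine (abs_add_le _ _).trans_lt ?_
  have h2 : |Real.exp (-∫ s in (0:ℝ)..t, h s) *
      ∫ r in a..t, W r * (h r * Real.exp (∫ s in (0:ℝ)..r, h s))| ≤ η / 2 := by
    rw [abs_mul, Real.abs_exp]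
    calc _ ≤ _ := mul_le_mul_of_nonneg_left hb (Real.exp_pos _).le
      _ = η / 2 := by
        rw [← hK, Real.exp_neg]
        field_simp
  linarith

/-- The deterministic analytic core of the proof of Proposition 2: if `h` is continuous on
`[0,1)`, bounded below by `−m`, with `∫₀ᵗ h → +∞` as `t → 1⁻`, and `N` is continuous on `[0,1]`,
then `N(t) − ∫₀ᵗ N(r) h(r) exp(−∫ᵣᵗ h(s) ds) dr → 0` as `t → 1⁻`. -/
theorem deterministic_core_limit
    (m : ℝ) (hm : 0 ≤ m)
    (h : ℝ → ℝ) (hh : ContinuousOn h (Set.Ico 0 1))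
    (hbd : ∀ t ∈ Set.Ico (0:ℝ) 1, -m ≤ h t)
    (hdiv : Tendsto (fun t => ∫ r in (0:ℝ)..t, h r) (𝓝[<] 1) atTop)
    (N : ℝ → ℝ) (hN : ContinuousOn N (Set.Icc 0 1)) :
    Tendsto
      (fun t => N t - ∫ r in (0:ℝ)..t, N r * h r * Real.exp (-∫ s in r..t, h s))
      (𝓝[<] 1) (𝓝 0) := by
  have hIco : Ico (0:ℝ) 1 ⊆ Icc 0 1 := Ico_subset_Icc_self
  have hN1 : Tendsto (fun t => N t - N 1) (𝓝[<] 1) (𝓝 0) := by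
    have h1 : Tendsto N (𝓝[<] 1) (𝓝 (N 1)) :=
      ((hN 1 (right_mem_Icc.2 zero_le_one)).mono_of_mem_nhdsWithin
        (mem_of_superset (Ioo_mem_nhdsLT zero_lt_one) Ioo_subset_Icc_self)).tendsto
    simpa using h1.sub_const (N 1)
  have hWc : ContinuousOn (fun t => N t - N 1) (Ico 0 1) :=
    (hN.mono hIco).sub continuousOn_const
  have hexp : Tendsto (fun t => Real.exp (-∫ s in (0:ℝ)..t, h s)) (𝓝[<] 1) (𝓝 0) :=
    Real.tendsto_exp_neg_atTop_nhds_zero.comp hdiv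
  have hlim := (hN1.add (hexp.const_mul (N 1))).sub
    (tendsto_exp_neg_mul_integral_mul_exp_primitive hm hh hbd hdiv hWc hN1)
  simp only [mul_zero, add_zero, sub_zero] at hlim
  refine hlim.congr' ?_
  filter_upwards [Ioo_mem_nhdsLT (zero_lt_one' ℝ)] with t ht
  have hc := continuousOn_mul_exp_primitive hh
  have hNc : ContinuousOn (fun r => N r * (h r * Real.exp (∫ s in (0:ℝ)..r, h s))) (Ico 0 1) :=
    (hN.mono hIco).mul hc
  have hi := intervalIntegrable_of_continuousOn_Ico hc le_rfl ht.1.le ht.2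
  have hiN := intervalIntegrable_of_continuousOn_Ico hNc le_rfl ht.1.le ht.2
  have hleft : ∫ r in (0:ℝ)..t, (N r - N 1) * (h r * Real.exp (∫ s in (0:ℝ)..r, h s)) =
      (∫ r in (0:ℝ)..t, N r * (h r * Real.exp (∫ s in (0:ℝ)..r, h s))) -
        N 1 * (Real.exp (∫ s in (0:ℝ)..t, h s) - 1) := by
    simp only [sub_mul]
    rw [intervalIntegral.integral_sub hiN (hi.const_mul _), intervalIntegral.integral_const_mul,
      integral_mul_exp_primitive hh le_rfl ht.1.le ht.2, intervalIntegral.integral_same,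
      Real.exp_zero]
  have hright : ∫ r in (0:ℝ)..t, N r * h r * Real.exp (-∫ s in r..t, h s) =
      Real.exp (-∫ s in (0:ℝ)..t, h s) *
        ∫ r in (0:ℝ)..t, N r * (h r * Real.exp (∫ s in (0:ℝ)..r, h s)) := by
    rw [← intervalIntegral.integral_const_mul]
    refine intervalIntegral.integral_congr fun r hr => ?_
    rw [uIcc_of_le ht.1.le] at hr
    have hadd := intervalIntegral.integral_add_adjacent_intervals
      (intervalIntegrable_of_continuousOn_Ico hh le_rfl hr.1 (hr.2.trans_lt ht.2))
      (intervalIntegrable_of_continuousOn_Ico hh hr.1 hr.2 ht.2)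
    have hsplit : -∫ s in r..t, h s =
        (-∫ s in (0:ℝ)..t, h s) + ∫ s in (0:ℝ)..r, h s := by linarith
    simp only [hsplit, Real.exp_add]
    ring
  rw [hleft, hright, Real.exp_neg]
  field_simp
  ring
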